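/- With the notation of the context, let ℓ₂ = 1/2 and let ℓ₁ be a half-odd-integer (ℓ₁ ∈ {1/2, 3/2, 5/2, …}). Then the vector w := χ_{1/2} − χ_{−1/2} satisfies D₀²w = −w, D₁w = −(ℓ₁² − 1/4)·w, D₂w = −(ℓ₁² + 2ℓ₁ + 3/4)·w, and D₃w = i(ℓ₁ + 1/2)·(χ_{1/2} + χ_{−1/2}). -/

import Mathlib

open TensorProduct

noncomputable section

namespace Spin

/-- The spin-`L/2` module data: `ψ m` represents the basis vector `ψ_{m/2}`
(indices are doubled so that they are integers; `ψ m = 0` for `|m| > L`), and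
`T₀, Tp, Tm` act by `T₀ψ_n = n ψ_n`, `Tpψ_n = -√((ℓ-n)(ℓ+n+1)) ψ_{n+1}`,
`Tmψ_n = -√((ℓ+n)(ℓ-n+1)) ψ_{n-1}`, where `ℓ = L/2` and `n = m/2`. -/
def IsSpinModule {U : Type} [AddCommGroup U] [Module ℂ U]
    (L : ℕ) (ψ : ℤ → U) (T₀ Tp Tm : U →ₗ[ℂ] U) : Prop :=
  (∀ m : ℤ, (L : ℤ) < |m| → ψ m = 0) ∧
  (∀ m : ℤ, T₀ (ψ m) = ((m : ℂ) / 2) • ψ m) ∧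
  (∀ m : ℤ, Tp (ψ m) =
    ((-Real.sqrt ((((L : ℝ) - (m : ℝ)) / 2) * (((L : ℝ) + (m : ℝ)) / 2 + 1)) : ℝ) : ℂ) •
      ψ (m + 2)) ∧
  (∀ m : ℤ, Tm (ψ m) =
    ((-Real.sqrt ((((L : ℝ) + (m : ℝ)) / 2) * (((L : ℝ) - (m : ℝ)) / 2 + 1)) : ℝ) : ℂ) •
      ψ (m - 2))

variable {U V : Type} [AddCommGroup U] [Module ℂ U] [AddCommGroup V] [Module ℂ V]

/-- Action of an operator on the first tensor factor. -/
def opT (T : U →ₗ[ℂ] U) : (U ⊗[ℂ] V) →ₗ[ℂ] (U ⊗[ℂ] V) := LinearMap.rTensor V T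

/-- Action of an operator on the second tensor factor. -/
def opW (W : V →ₗ[ℂ] V) : (U ⊗[ℂ] V) →ₗ[ℂ] (U ⊗[ℂ] V) := LinearMap.lTensor U W

/-- `D₀ = i(T₀ - W₀)`. -/
def Dzero (T₀ : U →ₗ[ℂ] U) (W₀ : V →ₗ[ℂ] V) : (U ⊗[ℂ] V) →ₗ[ℂ] (U ⊗[ℂ] V) :=
  Complex.I • (opT T₀ - opW W₀)

/-- `TpTm + TmTp + WpWm + WmWp`. -/
def Dquad (Tp Tm : U →ₗ[ℂ] U) (Wp Wm : V →ₗ[ℂ] V) : (U ⊗[ℂ] V) →ₗ[ℂ] (U ⊗[ℂ] V) :=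
  opT Tp ∘ₗ opT Tm + opT Tm ∘ₗ opT Tp + opW Wp ∘ₗ opW Wm + opW Wm ∘ₗ opW Wp

/-- `TpWm + TmWp`. -/
def Across (Tp Tm : U →ₗ[ℂ] U) (Wp Wm : V →ₗ[ℂ] V) : (U ⊗[ℂ] V) →ₗ[ℂ] (U ⊗[ℂ] V) :=
  opT Tp ∘ₗ opW Wm + opT Tm ∘ₗ opW Wp

/-- `D₁ = -(1/2)(TpTm + TmTp + WpWm + WmWp) - TpWm - TmWp`. -/
def Done (Tp Tm : U →ₗ[ℂ] U) (Wp Wm : V →ₗ[ℂ] V) : (U ⊗[ℂ] V) →ₗ[ℂ] (U ⊗[ℂ] V) :=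
  (-(1 / 2 : ℂ)) • Dquad Tp Tm Wp Wm - Across Tp Tm Wp Wm

/-- `D₂ = -(1/2)(TpTm + TmTp + WpWm + WmWp) + TpWm + TmWp`. -/
def Dtwo (Tp Tm : U →ₗ[ℂ] U) (Wp Wm : V →ₗ[ℂ] V) : (U ⊗[ℂ] V) →ₗ[ℂ] (U ⊗[ℂ] V) :=
  (-(1 / 2 : ℂ)) • Dquad Tp Tm Wp Wm + Across Tp Tm Wp Wm

/-- `D₃ = i(TmWp - TpWm)`. -/
def Dthree (Tp Tm : U →ₗ[ℂ] U) (Wp Wm : V →ₗ[ℂ] V) : (U ⊗[ℂ] V) →ₗ[ℂ] (U ⊗[ℂ] V) :=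
  Complex.I • (opT Tm ∘ₗ opW Wp - opT Tp ∘ₗ opW Wm)

end Spin

namespace Spin

variable {U V : Type} [AddCommGroup U] [Module ℂ U] [AddCommGroup V] [Module ℂ V]
  {L : ℕ} {ψ : ℤ → U} {T₀ Tp Tm : U →ₗ[ℂ] U}

@[simp]
theorem opT_tmul (T : U →ₗ[ℂ] U) (u : U) (v : V) : opT T (u ⊗ₜ[ℂ] v) = T u ⊗ₜ[ℂ] v :=
  rfl

@[simp]
theorem opW_tmul (W : V →ₗ[ℂ] V) (u : U) (v : V) : opW W (u ⊗ₜ[ℂ] v) = u ⊗ₜ[ℂ] W v :=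
  rfl

theorem ladder_coeff_nonneg {m : ℤ} (hm : |m| ≤ L) :
    0 ≤ (((L : ℝ) - m) / 2) * (((L : ℝ) + m) / 2 + 1) := by
  have h : |(m : ℝ)| ≤ L := by exact_mod_cast hm
  obtain ⟨h₁, h₂⟩ := abs_le.1 h
  exact mul_nonneg (by linarith) (by linarith)

theorem ofReal_neg_sqrt_mul_self {x : ℝ} (hx : 0 ≤ x) :
    ((-√x : ℝ) : ℂ) * ((-√x : ℝ) : ℂ) = (x : ℂ) := by
  rw [← Complex.ofReal_mul, neg_mul_neg, Real.mul_self_sqrt hx]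

/-- Lowering after raising multiplies `ψ_n` by `(ℓ - n)(ℓ + n + 1)`. -/
theorem IsSpinModule.lower_raise (h : IsSpinModule L ψ T₀ Tp Tm) {m : ℤ} (hm : |m| ≤ L) :
    Tm (Tp (ψ m)) = ((((L : ℂ) - m) / 2) * (((L : ℂ) + m) / 2 + 1)) • ψ m := by
  obtain ⟨-, -, hp, hq⟩ := h
  have e : (((L : ℝ) + ((m + 2 : ℤ) : ℝ)) / 2) * (((L : ℝ) - ((m + 2 : ℤ) : ℝ)) / 2 + 1)
      = (((L : ℝ) - m) / 2) * (((L : ℝ) + m) / 2 + 1) := by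
    push_cast
    ring
  rw [hp, map_smul, hq, e, smul_smul, ofReal_neg_sqrt_mul_self (ladder_coeff_nonneg hm),
    add_sub_cancel_right]
  push_cast
  rfl

/-- Raising after lowering multiplies `ψ_n` by `(ℓ + n)(ℓ - n + 1)`. -/
theorem IsSpinModule.raise_lower (h : IsSpinModule L ψ T₀ Tp Tm) {m : ℤ} (hm : |m| ≤ L) :
    Tp (Tm (ψ m)) = ((((L : ℂ) + m) / 2) * (((L : ℂ) - m) / 2 + 1)) • ψ m := by
  obtain ⟨-, -, hp, hq⟩ := h
  have e : (((L : ℝ) - ((m - 2 : ℤ) : ℝ)) / 2) * (((L : ℝ) + ((m - 2 : ℤ) : ℝ)) / 2 + 1)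
      = (((L : ℝ) + m) / 2) * (((L : ℝ) - m) / 2 + 1) := by
    push_cast
    ring
  have hnn : 0 ≤ (((L : ℝ) + m) / 2) * (((L : ℝ) - m) / 2 + 1) := by
    simpa [sub_eq_add_neg] using ladder_coeff_nonneg (m := -m) (by rwa [abs_neg])
  rw [hq, map_smul, hp, e, smul_smul, ofReal_neg_sqrt_mul_self hnn, sub_add_cancel]
  push_cast
  rfl

theorem IsSpinModule.raise_neg_one (h : IsSpinModule L ψ T₀ Tp Tm) :
    Tp (ψ (-1)) = (-(((L : ℂ) + 1) / 2)) • ψ 1 := by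
  have e : (((L : ℝ) - ((-1 : ℤ) : ℝ)) / 2) * (((L : ℝ) + ((-1 : ℤ) : ℝ)) / 2 + 1)
      = (((L : ℝ) + 1) / 2) ^ 2 := by
    push_cast
    ring
  rw [h.2.2.1, e, Real.sqrt_sq (by positivity)]
  push_cast
  rfl

theorem IsSpinModule.lower_one (h : IsSpinModule L ψ T₀ Tp Tm) :
    Tm (ψ 1) = (-(((L : ℂ) + 1) / 2)) • ψ (-1) := by
  have e : (((L : ℝ) + ((1 : ℤ) : ℝ)) / 2) * (((L : ℝ) - ((1 : ℤ) : ℝ)) / 2 + 1)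
      = (((L : ℝ) + 1) / 2) ^ 2 := by
    push_cast
    ring
  rw [h.2.2.2, e, Real.sqrt_sq (by positivity)]
  push_cast
  rfl

theorem IsSpinModule.raise_one_of_spin_half (h : IsSpinModule 1 ψ T₀ Tp Tm) : Tp (ψ 1) = 0 := by
  rw [h.2.2.1, h.1 (1 + 2) (by norm_num), smul_zero]

theorem IsSpinModule.lower_neg_one_of_spin_half (h : IsSpinModule 1 ψ T₀ Tp Tm) :
    Tm (ψ (-1)) = 0 := by
  rw [h.2.2.2, h.1 (-1 - 2) (by norm_num), smul_zero]

end Spin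

/- STATEMENT 14: For ℓ₂ = 1/2 (doubled spin 1) and ℓ₁ = k + 1/2 a half-odd-integer
(doubled spin 2k+1), the vector w = χ_{1/2} - χ_{-1/2} = ψ 1 ⊗ φ (-1) - ψ (-1) ⊗ φ 1
satisfies D₀²w = -w, D₁w = -(ℓ₁² - 1/4)·w, D₂w = -(ℓ₁² + 2ℓ₁ + 3/4)·w and
D₃w = i(ℓ₁ + 1/2)·(χ_{1/2} + χ_{-1/2}). -/

open Spin in
theorem stmt14 {U V : Type} [AddCommGroup U] [Module ℂ U] [AddCommGroup V] [Module ℂ V]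
    (k : ℕ) (ψ : ℤ → U) (φ : ℤ → V)
    (T₀ Tp Tm : U →ₗ[ℂ] U) (W₀ Wp Wm : V →ₗ[ℂ] V)
    (hU : IsSpinModule (2 * k + 1) ψ T₀ Tp Tm) (hV : IsSpinModule 1 φ W₀ Wp Wm) :
    Dzero T₀ W₀ (Dzero T₀ W₀ (ψ 1 ⊗ₜ[ℂ] φ (-1) - ψ (-1) ⊗ₜ[ℂ] φ 1))
      = -(ψ 1 ⊗ₜ[ℂ] φ (-1) - ψ (-1) ⊗ₜ[ℂ] φ 1) ∧
    Done Tp Tm Wp Wm (ψ 1 ⊗ₜ[ℂ] φ (-1) - ψ (-1) ⊗ₜ[ℂ] φ 1)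
      = (-(((2 * (k : ℂ) + 1) / 2) ^ 2 - 1 / 4)) •
          (ψ 1 ⊗ₜ[ℂ] φ (-1) - ψ (-1) ⊗ₜ[ℂ] φ 1) ∧
    Dtwo Tp Tm Wp Wm (ψ 1 ⊗ₜ[ℂ] φ (-1) - ψ (-1) ⊗ₜ[ℂ] φ 1)
      = (-(((2 * (k : ℂ) + 1) / 2) ^ 2 + 2 * ((2 * (k : ℂ) + 1) / 2) + 3 / 4)) •
          (ψ 1 ⊗ₜ[ℂ] φ (-1) - ψ (-1) ⊗ₜ[ℂ] φ 1) ∧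
    Dthree Tp Tm Wp Wm (ψ 1 ⊗ₜ[ℂ] φ (-1) - ψ (-1) ⊗ₜ[ℂ] φ 1)
      = (Complex.I * ((2 * (k : ℂ) + 1) / 2 + 1 / 2)) •
          (ψ 1 ⊗ₜ[ℂ] φ (-1) + ψ (-1) ⊗ₜ[ℂ] φ 1) := by
  have hone : |(1 : ℤ)| ≤ ((2 * k + 1 : ℕ) : ℤ) := by rw [abs_one]; lia
  have hneg : |(-1 : ℤ)| ≤ ((2 * k + 1 : ℕ) : ℤ) := by rw [abs_neg, abs_one]; lia
  refine ⟨?_, ?_, ?_, ?_⟩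
  · simp only [Dzero, LinearMap.smul_apply, LinearMap.sub_apply, map_sub, map_smul, opT_tmul,
      opW_tmul, hU.2.1, hV.2.1, ← smul_tmul', tmul_smul]
    push_cast
    match_scalars
    · linear_combination Complex.I_mul_I
    · linear_combination -Complex.I_mul_I
  all_goals
    simp only [Done, Dtwo, Dthree, Dquad, Across, LinearMap.smul_apply, LinearMap.sub_apply,
      LinearMap.add_apply, LinearMap.comp_apply, map_sub, opT_tmul, opW_tmul,
      hU.lower_raise hone, hU.raise_lower hneg,
      hU.raise_neg_one, hU.lower_one, hV.raise_neg_one, hV.lower_one,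
      hV.raise_one_of_spin_half, hV.lower_neg_one_of_spin_half, map_smul, map_zero,
      ← smul_tmul', tmul_smul, tmul_zero]
    push_cast
    module
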